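/- (Lipschitz projection with separation) Let N ≥ 2 and let D = {(x_i, y_i)}_{i=1}^N be a dataset in ℝ^d with separation constant ε_D. For any α ∈ (0, 1) and any integer m with 24·α^{−2}·log N ≤ m ≤ d, there exist a 1-Lipschitz linear map φ : ℝ^d → ℝ^m and a real β > 0 such that: the projected dataset D' = {(φ(x_i), y_i)}_{i=1}^N has separation constant ε_{D'} ≥ (1 − α)·β·ε_D; the points φ(x_1), …, φ(x_N) are pairwise distinct; and if m ≥ 10·log d then β ≥ (1/2)·√(m/d). -/

import Mathlib

/-- The separation constant `ε_D = (1/2) · min{‖x_i - x_j‖ : y_i ≠ y_j}` of a labeled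
dataset `(x, y)`. -/
noncomputable def sepConst {E : Type*} [NormedAddCommGroup E] {N : ℕ} {L : Type*}
    (x : Fin N → E) (y : Fin N → L) : ℝ :=
  (1 / 2) * sInf {r : ℝ | ∃ i j : Fin N, y i ≠ y j ∧ r = ‖x i - x j‖}

open MeasureTheory ProbabilityTheory

lemma gauss_one_dim (b : ℝ) (hb : 0 < b) :
    ∫ x, Real.exp (-((b - 1) / 2) * x ^ 2) ∂(gaussianReal 0 1) = (√b)⁻¹ := by
  rw [integral_gaussianReal_eq_integral_smul (by simp)]
  have h : ∀ x : ℝ, gaussianPDFReal 0 1 x • Real.exp (-((b - 1) / 2) * x ^ 2)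
      = (√(2 * Real.pi))⁻¹ * Real.exp (-(b / 2) * x ^ 2) := by
    intro x
    simp only [gaussianPDFReal, smul_eq_mul, NNReal.coe_one, mul_one, sub_zero]
    rw [mul_assoc, ← Real.exp_add]
    congr 2
    ring
  simp_rw [h]
  rw [integral_const_mul, integral_gaussian]
  rw [← Real.sqrt_inv, ← Real.sqrt_mul (by positivity), ← Real.sqrt_inv]
  congr 1
  field_simp

/-- Coordinate projection. -/
noncomputable def coordProj (m k : ℕ) :
    EuclideanSpace ℝ (Fin (m + k)) →ₗ[ℝ] EuclideanSpace ℝ (Fin m) where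
  toFun x := WithLp.toLp 2 (fun i => x (Fin.castAdd k i))
  map_add' x y := by ext i; simp
  map_smul' c x := by ext i; simp

lemma coordProj_norm_sq (m k : ℕ) (x : EuclideanSpace ℝ (Fin (m + k))) :
    ‖coordProj m k x‖ ^ 2 = ∑ i : Fin m, x (Fin.castAdd k i) ^ 2 := by
  simp [EuclideanSpace.norm_sq_eq, coordProj]

lemma full_norm_sq (m k : ℕ) (x : EuclideanSpace ℝ (Fin (m + k))) :
    ‖x‖ ^ 2 = ∑ i : Fin m, x (Fin.castAdd k i) ^ 2 + ∑ i : Fin k, x (Fin.natAdd m i) ^ 2 := by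
  simp [EuclideanSpace.norm_sq_eq, Fin.sum_univ_add]

lemma coordProj_norm_le (m k : ℕ) (x : EuclideanSpace ℝ (Fin (m + k))) :
    ‖coordProj m k x‖ ≤ ‖x‖ := by
  refine le_of_sq_le_sq ?_ (norm_nonneg _)
  rw [coordProj_norm_sq, full_norm_sq]
  have : 0 ≤ ∑ i : Fin k, x (Fin.natAdd m i) ^ 2 := Finset.sum_nonneg fun i _ => sq_nonneg _
  linarith

/-- Cone of vectors that are shrunk too much. -/
def badCone (m k : ℕ) (τ : ℝ) : Set (EuclideanSpace ℝ (Fin (m + k))) :=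
  {x | ‖coordProj m k x‖ ^ 2 ≤ τ * ‖x‖ ^ 2}

lemma isClosed_badCone (m k : ℕ) (τ : ℝ) : IsClosed (badCone m k τ) := by
  have := (coordProj m k).continuous_of_finiteDimensional
  exact isClosed_le (by fun_prop) (by fun_prop)

lemma chernoff (m k : ℕ) (τ : ℝ) (hτ1 : τ < 1) :
    (stdGaussian (EuclideanSpace ℝ (Fin (m + k)))).real (badCone m k τ)
      ≤ (√(2 - τ))⁻¹ ^ m * (√(1 - τ))⁻¹ ^ k := by
  have hmeas : MeasurableSet (badCone m k τ) := (isClosed_badCone m k τ).measurableSet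
  let b : Fin (m + k) → ℝ := Fin.addCases (fun _ => 2 - τ) (fun _ => 1 - τ)
  have hb : ∀ i, 0 < b i := by
    intro i
    refine Fin.addCases (fun i => ?_) (fun i => ?_) i <;> simp [b] <;> linarith
  let f : (Fin (m + k) → ℝ) → ℝ := fun x => ∏ i, Real.exp (-((b i - 1) / 2) * x i ^ 2)
  have hint : ∫ x, f x ∂(Measure.pi (fun _ : Fin (m + k) => gaussianReal 0 1))
      = (√(2 - τ))⁻¹ ^ m * (√(1 - τ))⁻¹ ^ k := by
    rw [integral_fintype_prod_eq_prod (f := fun i x => Real.exp (-((b i - 1) / 2) * x ^ 2))]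
    rw [Finset.prod_congr rfl (fun i _ => gauss_one_dim (b i) (hb i)), Fin.prod_univ_add]
    simp [b]
  have hpos : 0 < (√(2 - τ))⁻¹ ^ m * (√(1 - τ))⁻¹ ^ k := by
    have := Real.sqrt_pos.2 (show 0 < 2 - τ by linarith)
    have := Real.sqrt_pos.2 (show 0 < 1 - τ by linarith)
    positivity
  have hI : Integrable f (Measure.pi (fun _ : Fin (m + k) => gaussianReal 0 1)) := by
    by_contra h
    rw [integral_undef h] at hint
    linarith
  rw [← map_pi_eq_stdGaussian, map_measureReal_apply (by fun_prop) hmeas, ← hint,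
    ← integral_indicator_one (hmeas.preimage (by fun_prop))]
  refine integral_mono_of_nonneg (ae_of_all _ fun x => ?_) hI (ae_of_all _ fun x => ?_)
  · exact Set.indicator_nonneg (fun _ _ => zero_le_one) _
  · refine Set.indicator_le' (fun x hx => ?_) (fun x _ => ?_) x
    · simp only [Set.mem_preimage, badCone, Set.mem_ofPred_eq] at hx
      rw [coordProj_norm_sq, full_norm_sq] at hx
      simp only [f, ← Real.exp_sum, Pi.one_apply]
      apply Real.one_le_exp
      rw [Fin.sum_univ_add]
      simp only [b, Fin.addCases_left, Fin.addCases_right, ← Finset.mul_sum]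
      linarith
    · exact Finset.prod_nonneg fun i _ => (Real.exp_pos _).le

lemma numeric (m k N : ℕ) (hm : 0 < m) (hN : 2 ≤ N) (h : 24 * Real.log N ≤ m) :
    (N : ℝ) ^ 2 * ((√(2 - m / (4 * ((m : ℝ) + k))))⁻¹ ^ m *
      (√(1 - m / (4 * ((m : ℝ) + k))))⁻¹ ^ k) < 1 := by
  have hm' : (0 : ℝ) < m := by exact_mod_cast hm
  have hk : (0 : ℝ) ≤ k := by positivity
  have hN0 : (0 : ℝ) < N := by positivity
  set τ : ℝ := m / (4 * ((m : ℝ) + k)) with hτ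
  have hτ0 : 0 < τ := by positivity
  have hτ1 : τ ≤ 1 / 4 := by
    rw [hτ, div_le_iff₀ (by positivity)]; linarith
  have hkτ : k * τ ≤ (m / 4) * (1 - τ) := by
    have : τ * (4 * ((m : ℝ) + k)) = m := by rw [hτ]; field_simp
    nlinarith
  have h1 : (0 : ℝ) < 1 - τ := by linarith
  have h2 : (0 : ℝ) < 2 - τ := by linarith
  rw [← sq_lt_one_iff₀ (by positivity)]
  rw [mul_pow, mul_pow, ← pow_mul _ m, ← pow_mul _ k, mul_comm m 2, mul_comm k 2, pow_mul _ 2 m,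
    pow_mul _ 2 k, inv_pow (√(2 - τ)) 2, inv_pow (√(1 - τ)) 2, Real.sq_sqrt h2.le, Real.sq_sqrt h1.le]
  have a1 : ((N : ℝ) ^ 2) ^ 2 ≤ Real.exp (1 / 6) ^ m := by
    rw [← Real.exp_nat_mul, ← Real.exp_log hN0, ← Real.exp_nat_mul, ← Real.exp_nat_mul]
    apply Real.exp_le_exp.2
    push_cast; linarith
  have a2 : (2 - τ)⁻¹ ^ m ≤ (4 / 7 : ℝ) ^ m := by
    refine pow_le_pow_left₀ (by positivity) ?_ _
    rw [inv_le_comm₀ h2 (by norm_num)]; linarith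
  have a3 : (1 - τ)⁻¹ ^ k ≤ Real.exp (1 / 4) ^ m := by
    have e : (1 - τ)⁻¹ ≤ Real.exp (τ / (1 - τ)) := by
      have := Real.add_one_le_exp (τ / (1 - τ))
      have e2 : τ / (1 - τ) + 1 = (1 - τ)⁻¹ := by field_simp; ring
      linarith
    calc (1 - τ)⁻¹ ^ k ≤ Real.exp (τ / (1 - τ)) ^ k := pow_le_pow_left₀ (by positivity) e _
      _ = Real.exp (k * (τ / (1 - τ))) := by rw [Real.exp_nat_mul]
      _ ≤ Real.exp (m * (1 / 4)) := by
        apply Real.exp_le_exp.2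
        rw [← mul_div_assoc, div_le_iff₀ h1]; linarith
      _ = _ := by rw [Real.exp_nat_mul]
  calc _ ≤ Real.exp (1 / 6) ^ m * ((4 / 7 : ℝ) ^ m * Real.exp (1 / 4) ^ m) := by gcongr
    _ = (Real.exp (5 / 12) * (4 / 7)) ^ m := by
      rw [← mul_pow, ← mul_pow]
      congr 1
      rw [show (5 / 12 : ℝ) = 1 / 6 + 1 / 4 by norm_num, Real.exp_add]; ring
    _ < 1 := by
      apply pow_lt_one₀ (by positivity) _ hm.ne'
      have : Real.exp (5 / 12) < 7 / 4 := by
        have : (7 / 12 : ℝ) ≤ Real.exp (-(5 / 12)) := by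
          have := Real.add_one_le_exp (-(5 / 12) : ℝ); linarith
        rw [Real.exp_neg] at this
        have h3 := (le_inv_comm₀ (by norm_num) (Real.exp_pos _)).1 this
        norm_num at h3
        linarith
      linarith

/-- The orthogonal group. -/
noncomputable abbrev OG (d : ℕ) : Type := unitary (EuclideanSpace ℝ (Fin d) →L[ℝ] EuclideanSpace ℝ (Fin d))

instance OG_star (d : ℕ) :
    ContinuousStar (EuclideanSpace ℝ (Fin d) →L[ℝ] EuclideanSpace ℝ (Fin d)) :=
  ⟨(ContinuousLinearMap.adjoint (𝕜 := ℝ) (E := EuclideanSpace ℝ (Fin d))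
      (F := EuclideanSpace ℝ (Fin d))).continuous⟩

instance OG_compact (d : ℕ) : CompactSpace (OG d) := by
  refine (isCompact_iff_compactSpace (s := (unitary (EuclideanSpace ℝ (Fin d) →L[ℝ]
    EuclideanSpace ℝ (Fin d)) : Set (EuclideanSpace ℝ (Fin d) →L[ℝ] EuclideanSpace ℝ (Fin d))))).1 ?_
  have : ProperSpace (EuclideanSpace ℝ (Fin d) →L[ℝ] EuclideanSpace ℝ (Fin d)) :=
    FiniteDimensional.proper ℝ _
  refine Metric.isCompact_of_isClosed_isBounded isClosed_unitary ?_
  refine (Metric.isBounded_closedBall (x := 0) (r := 1)).subset fun u hu => ?_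
  rw [mem_closedBall_zero_iff]
  exact ContinuousLinearMap.opNorm_le_bound _ zero_le_one fun x => by
    rw [one_mul]; exact (Unitary.norm_map ⟨u, hu⟩ x).le

lemma haar_bound (d : ℕ) (B : Set (EuclideanSpace ℝ (Fin d))) (hB : IsClosed B)
    (hcone : ∀ (c : ℝ) x, x ∈ B → c • x ∈ B) (h0 : (0 : EuclideanSpace ℝ (Fin d)) ∈ B)
    [MeasurableSpace (OG d)] [BorelSpace (OG d)]
    (μ : Measure (OG d)) [IsProbabilityMeasure μ] [μ.IsMulLeftInvariant]
    (u : EuclideanSpace ℝ (Fin d)) (hu : u ≠ 0) :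
    μ {O | ((O⁻¹ : OG d) : EuclideanSpace ℝ (Fin d) →L[ℝ] EuclideanSpace ℝ (Fin d)) u ∈ B}
      ≤ stdGaussian (EuclideanSpace ℝ (Fin d)) B := by
  have : ProperSpace (EuclideanSpace ℝ (Fin d) →L[ℝ] EuclideanSpace ℝ (Fin d)) :=
    FiniteDimensional.proper ℝ _
  have : SecondCountableTopology (OG d) := TopologicalSpace.Subtype.secondCountableTopology _
  set ν := stdGaussian (EuclideanSpace ℝ (Fin d))
  let S : EuclideanSpace ℝ (Fin d) → Set (OG d) := fun u =>
    {O | ((O⁻¹ : OG d) : EuclideanSpace ℝ (Fin d) →L[ℝ] EuclideanSpace ℝ (Fin d)) u ∈ B}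
  change μ (S u) ≤ ν B
  have key : ∀ g, μ (S u) ≤ μ (S g) := by
    intro g
    by_cases hg : g = 0
    · have : S g = Set.univ := by ext O; simp [S, hg, h0]
      rw [this]; exact measure_mono (Set.subset_univ _)
    have hgn : ‖g‖ ≠ 0 := norm_ne_zero_iff.2 hg
    have hun : ‖u‖ ≠ 0 := norm_ne_zero_iff.2 hu
    let g' := (‖u‖ / ‖g‖) • g
    have hg' : ‖u‖ = ‖g'‖ := by
      simp only [g', norm_smul, norm_div, norm_norm]; field_simp
    let R : OG d := Unitary.linearIsometryEquiv.symm (Submodule.reflection (ℝ ∙ (u - g'))ᗮ)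
    have hR : (R : EuclideanSpace ℝ (Fin d) →L[ℝ] EuclideanSpace ℝ (Fin d)) u = g' :=
      Submodule.reflection_sub hg'
    rw [← measure_preimage_mul μ R⁻¹ (S u)]
    refine measure_mono fun O hO => ?_
    simp only [S, Set.mem_preimage, Set.mem_ofPred_eq, mul_inv_rev, inv_inv] at hO ⊢
    rw [Submonoid.coe_mul, mul_apply_eq_comp, hR] at hO
    have := hcone (‖g‖ / ‖u‖) _ hO
    rw [← map_smul] at this
    convert this using 2
    simp only [g', smul_smul]
    rw [show ‖g‖ / ‖u‖ * (‖u‖ / ‖g‖) = 1 by field_simp, one_smul]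
  let T : Set (EuclideanSpace ℝ (Fin d) × OG d) := {p |
    ((p.2⁻¹ : OG d) : EuclideanSpace ℝ (Fin d) →L[ℝ] EuclideanSpace ℝ (Fin d)) p.1 ∈ B}
  have hT : MeasurableSet T := by
    apply IsClosed.measurableSet
    refine hB.preimage ?_
    have : Continuous fun p : EuclideanSpace ℝ (Fin d) × OG d => ((p.2⁻¹ : OG d) :
      EuclideanSpace ℝ (Fin d) →L[ℝ] EuclideanSpace ℝ (Fin d)) :=
      continuous_subtype_val.comp (continuous_inv.comp continuous_snd)
    exact this.clm_apply continuous_fst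
  calc μ (S u) = ∫⁻ g, μ (S u) ∂ν := by simp
    _ ≤ ∫⁻ g, μ (S g) ∂ν := lintegral_mono key
    _ = (ν.prod μ) T := by rw [Measure.prod_apply hT]; rfl
    _ = ∫⁻ O, ν ((fun g => (g, O)) ⁻¹' T) ∂μ := by rw [Measure.prod_apply_symm hT]
    _ = ∫⁻ O, ν B ∂μ := by
      congr 1; ext O
      have h := stdGaussian_map (Unitary.linearIsometryEquiv (O⁻¹ : OG d))
      conv_rhs => rw [show ν = _ from h.symm]
      rw [Measure.map_apply (by fun_prop) hB.measurableSet]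
      rfl
    _ = ν B := by simp

lemma exists_good (m k N : ℕ) (hm : 0 < m) (hN : 2 ≤ N) (h : 24 * Real.log N ≤ m)
    (v : Fin N → Fin N → EuclideanSpace ℝ (Fin (m + k))) :
    ∃ φ : EuclideanSpace ℝ (Fin (m + k)) →ₗ[ℝ] EuclideanSpace ℝ (Fin m),
      (∀ w, ‖φ w‖ ≤ ‖w‖) ∧
      ∀ i j, v i j ≠ 0 → (1 / 2) * √((m : ℝ) / ((m : ℝ) + k)) * ‖v i j‖ < ‖φ (v i j)‖ := by
  classical
  let : MeasurableSpace (OG (m + k)) := borel _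
  have : BorelSpace (OG (m + k)) := ⟨rfl⟩
  let μ : Measure (OG (m + k)) := Measure.haarMeasure ⊤
  have : IsProbabilityMeasure μ := ⟨by
    have := Measure.haarMeasure_self (K₀ := (⊤ : TopologicalSpace.PositiveCompacts (OG (m + k))))
    simpa using this⟩
  have hm' : (0 : ℝ) < m := by exact_mod_cast hm
  have hk : (0 : ℝ) ≤ k := by positivity
  set τ : ℝ := m / (4 * ((m : ℝ) + k)) with hτ
  have hτ0 : 0 < τ := by positivity
  have hτ1 : τ ≤ 1 / 4 := by
    rw [hτ, div_le_iff₀ (by positivity)]; linarith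
  let B := badCone m k τ
  let S : Fin N × Fin N → Set (OG (m + k)) := fun p => {O | v p.1 p.2 ≠ 0 ∧
    ((O⁻¹ : OG (m + k)) : EuclideanSpace ℝ (Fin (m + k)) →L[ℝ] EuclideanSpace ℝ (Fin (m + k)))
      (v p.1 p.2) ∈ B}
  have hS : ∀ p, μ (S p) ≤ stdGaussian (EuclideanSpace ℝ (Fin (m + k))) B := by
    intro p
    by_cases hp : v p.1 p.2 = 0
    · simp [S, hp]
    · refine (measure_mono fun O hO => hO.2).trans
        (haar_bound (m + k) B (isClosed_badCone m k τ) ?_ ?_ μ (v p.1 p.2) hp)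
      · intro c x hx
        simp only [B, badCone, Set.mem_ofPred_eq, map_smul, norm_smul, mul_pow] at hx ⊢
        nlinarith [sq_nonneg ‖c‖]
      · simp [B, badCone]
  have hU : μ (⋃ p, S p) < 1 := by
    calc μ (⋃ p, S p) ≤ ∑ p, μ (S p) := measure_iUnion_fintype_le _ _
      _ ≤ ∑ p : Fin N × Fin N, stdGaussian (EuclideanSpace ℝ (Fin (m + k))) B :=
        Finset.sum_le_sum fun p _ => hS p
      _ = ENNReal.ofReal ((N : ℝ) ^ 2 *
            (stdGaussian (EuclideanSpace ℝ (Fin (m + k)))).real B) := by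
        rw [ENNReal.ofReal_mul (by positivity), ofReal_measureReal]
        simp [sq, ENNReal.ofReal_mul]
      _ < 1 := by
        rw [ENNReal.ofReal_lt_one]
        refine lt_of_le_of_lt ?_ (numeric m k N hm hN h)
        exact mul_le_mul_of_nonneg_left (chernoff m k τ (by linarith)) (by positivity)
  obtain ⟨O, hO⟩ : ∃ O, O ∉ ⋃ p, S p := by
    by_contra! hcon
    rw [Set.eq_univ_of_forall hcon] at hU
    simp at hU
  refine ⟨coordProj m k ∘ₗ ((O⁻¹ : OG (m + k)) : EuclideanSpace ℝ (Fin (m + k)) →L[ℝ]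
    EuclideanSpace ℝ (Fin (m + k))).toLinearMap, fun w => ?_, fun i j hij => ?_⟩
  · exact (coordProj_norm_le m k _).trans (Unitary.norm_map _ _).le
  · have h1 : O ∉ S (i, j) := fun hh => hO (Set.mem_iUnion.2 ⟨_, hh⟩)
    simp only [S, Set.mem_ofPred_eq, not_and] at h1
    have h2 := h1 hij
    simp only [B, badCone, Set.mem_ofPred_eq, not_le, Unitary.norm_map] at h2
    refine lt_of_pow_lt_pow_left₀ 2 (norm_nonneg _) ?_
    refine lt_of_eq_of_lt ?_ h2
    rw [mul_pow, mul_pow, Real.sq_sqrt (by positivity), hτ]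
    field_simp
    norm_num

/-- **Lipschitz projection with separation.** For a dataset
`D = {(x_i, y_i)}` in `ℝ^d` with `N ≥ 2`, any `α ∈ (0,1)` and any integer `m` with
`24 α⁻² log N ≤ m ≤ d`, there are a 1-Lipschitz linear map `φ : ℝ^d → ℝ^m` and `β > 0`
such that the projected dataset has separation `≥ (1-α) β ε_D`, the projected points
are pairwise distinct, and `β ≥ (1/2)√(m/d)` whenever `m ≥ 10 log d`. -/
theorem lipschitz_projection_with_separation
    (d N C : ℕ) (hN : 2 ≤ N)
    (x : Fin N → EuclideanSpace ℝ (Fin d)) (y : Fin N → Fin C)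
    (hinj : Function.Injective x) (hlabels : ∃ i j : Fin N, y i ≠ y j)
    (α : ℝ) (hα0 : 0 < α) (hα1 : α < 1)
    (m : ℕ) (hm1 : 24 * Real.log N / α ^ 2 ≤ (m : ℝ)) (hm2 : m ≤ d) :
    ∃ (φ : EuclideanSpace ℝ (Fin d) →ₗ[ℝ] EuclideanSpace ℝ (Fin m)) (β : ℝ),
      0 < β ∧
      (∀ v : EuclideanSpace ℝ (Fin d), ‖φ v‖ ≤ ‖v‖) ∧
      Function.Injective (fun i : Fin N => φ (x i)) ∧
      (1 - α) * β * sepConst x y ≤ sepConst (fun i : Fin N => φ (x i)) y ∧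
      (10 * Real.log d ≤ (m : ℝ) → (1 / 2) * Real.sqrt ((m : ℝ) / d) ≤ β) := by
  obtain ⟨k, rfl⟩ := Nat.exists_eq_add_of_le hm2
  have hN' : (2 : ℝ) ≤ N := by exact_mod_cast hN
  have hlog : 0 < Real.log N := Real.log_pos (by linarith)
  have hα2 : α ^ 2 ≤ 1 := by nlinarith
  have h24 : 24 * Real.log N ≤ m := by
    refine le_trans ?_ hm1
    rw [le_div_iff₀ (by positivity)]
    nlinarith
  have hm' : (0 : ℝ) < m := by linarith
  have hm : 0 < m := by exact_mod_cast hm'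
  obtain ⟨φ, hφ1, hφ2⟩ := exists_good m k N hm hN h24 (fun i j => x i - x j)
  have hβ : 0 < (1 / 2) * √((m : ℝ) / ((m : ℝ) + k)) := by positivity
  refine ⟨φ, (1 / 2) * √((m : ℝ) / ((m : ℝ) + k)), hβ, hφ1, ?_, ?_, ?_⟩
  · intro i j hij
    by_contra hne
    have hx : x i - x j ≠ 0 := sub_ne_zero.2 fun h => hne (hinj h)
    have h1 := hφ2 i j hx
    have h2 : φ (x i) = φ (x j) := hij
    rw [map_sub, h2, sub_self, norm_zero] at h1
    have : 0 < ‖x i - x j‖ := norm_pos_iff.2 hx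
    nlinarith [mul_pos hβ this]
  · unfold sepConst
    set β := (1 / 2) * √((m : ℝ) / ((m : ℝ) + k))
    set A := sInf {r : ℝ | ∃ i j : Fin N, y i ≠ y j ∧ r = ‖x i - x j‖} with hA
    have hbdd : BddBelow {r : ℝ | ∃ i j : Fin N, y i ≠ y j ∧ r = ‖x i - x j‖} :=
      ⟨0, by rintro r ⟨i, j, _, rfl⟩; exact norm_nonneg _⟩
    have hmain : (1 - α) * β * A ≤
        sInf {r : ℝ | ∃ i j : Fin N, y i ≠ y j ∧ r = ‖φ (x i) - φ (x j)‖} := by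
      obtain ⟨i0, j0, h0⟩ := hlabels
      refine le_csInf ⟨_, i0, j0, h0, rfl⟩ ?_
      rintro r ⟨i, j, hij, rfl⟩
      have hx : x i - x j ≠ 0 := sub_ne_zero.2 fun h => hij (by rw [hinj h])
      have h1 := hφ2 i j hx
      rw [map_sub] at h1
      have hAle : A ≤ ‖x i - x j‖ := csInf_le hbdd ⟨i, j, hij, rfl⟩
      have h3 : (1 - α) * β * A ≤ (1 - α) * β * ‖x i - x j‖ :=
        mul_le_mul_of_nonneg_left hAle (mul_nonneg (by linarith) hβ.le)
      have h4 : 0 ≤ α * (β * ‖x i - x j‖) := by positivity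
      linarith
    linarith
  · intro _
    push_cast
    exact le_rfl
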